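/- arXiv:2604.24207 — 3 statements merged into one kernel-verified Lean document; each statement's English description precedes it below -/
import Mathlib

section
/- The polynomials c_n(t) satisfy the recursion c_{2n}(t) = (1+t)·c_{2n-1}(t) for n ≥ 1, and c_{2n+1}(t) = (1+t)·c_{2n}(t) - t·C_n(t²) for n ≥ 0, where C_n denotes the n-th Narayana polynomial. -/
open Polynomial Finset

/-- The Jacobi-type array: `a 0 k = [k = 0]`, and
`a (n+1) k = a n (k-1) + s k * a n k + t k * a n (k+1)` with `a n (-1) = 0`. -/
def jacobiA {R : Type*} [CommRing R] (s t : ℕ → R) : ℕ → ℕ → R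
  | 0, k => if k = 0 then 1 else 0
  | n+1, k =>
      (if k = 0 then 0 else jacobiA s t n (k-1)) + s k * jacobiA s t n k
        + t k * jacobiA s t n (k+1)

/-- The Narayana polynomial `C_n(t) ∈ ℤ[t]`:
`C_0(t) = 1` and `C_n(t) = ∑_{k=0}^{n-1} (1/(k+1))·binom(n,k)·binom(n-1,k)·t^k` for `n ≥ 1`. -/
noncomputable def narayana (n : ℕ) : Polynomial ℤ :=
  if n = 0 then 1 else
    ∑ k ∈ Finset.range n,
      Polynomial.C ((n.choose k * (n-1).choose k / (k+1) : ℕ) : ℤ) * Polynomial.X ^ k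

/-- The polynomial `c_n(t) = C_n(t;-1) ∈ ℤ[t]`: `c_0(t) = 1` and
`c_n(t) = ∑_{k=0}^{n} binom(⌊(n-1)/2⌋,⌊k/2⌋)·binom(⌊n/2⌋,⌊(k+1)/2⌋)·t^k` for `n ≥ 1`. -/
noncomputable def cnar (n : ℕ) : Polynomial ℤ :=
  if n = 0 then 1 else
    ∑ k ∈ Finset.range (n+1),
      Polynomial.C ((((n-1)/2).choose (k/2) * (n/2).choose ((k+1)/2) : ℕ) : ℤ) * Polynomial.X ^ k


/-- The binomial product in `cnar` vanishes outside the range of summation. -/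
theorem coeff_cnar_succ (n k : ℕ) :
    (cnar (n + 1)).coeff k =
      (((n / 2).choose (k / 2) * ((n + 1) / 2).choose ((k + 1) / 2) : ℕ) : ℤ) := by
  simp only [cnar, Nat.add_one_ne_zero, if_false, finsetSum_coeff, coeff_C_mul_X_pow,
    Nat.add_sub_cancel, sum_ite_eq, mem_range]
  split_ifs with h
  · rfl
  · rw [Nat.choose_eq_zero_of_lt (by omega : n / 2 < k / 2), zero_mul, Nat.cast_zero]

theorem coeff_cnar_odd_even (m j : ℕ) :
    (cnar (2 * m + 1)).coeff (2 * j) = (m.choose j : ℤ) * m.choose j := by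
  rw [coeff_cnar_succ, show 2 * m / 2 = m by omega, show (2 * m + 1) / 2 = m by omega,
    show 2 * j / 2 = j by omega, show (2 * j + 1) / 2 = j by omega, Nat.cast_mul]

theorem coeff_cnar_odd_odd (m j : ℕ) :
    (cnar (2 * m + 1)).coeff (2 * j + 1) = (m.choose j : ℤ) * m.choose (j + 1) := by
  rw [coeff_cnar_succ, show 2 * m / 2 = m by omega, show (2 * m + 1) / 2 = m by omega,
    show (2 * j + 1) / 2 = j by omega, show (2 * j + 1 + 1) / 2 = j + 1 by omega, Nat.cast_mul]

theorem coeff_cnar_even_even (m j : ℕ) :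
    (cnar (2 * m + 2)).coeff (2 * j) = (m.choose j : ℤ) * (m + 1).choose j := by
  rw [coeff_cnar_succ, show (2 * m + 1) / 2 = m by omega,
    show (2 * m + 1 + 1) / 2 = m + 1 by omega,
    show 2 * j / 2 = j by omega, show (2 * j + 1) / 2 = j by omega, Nat.cast_mul]

theorem coeff_cnar_even_odd (m j : ℕ) :
    (cnar (2 * m + 2)).coeff (2 * j + 1) = (m.choose j : ℤ) * (m + 1).choose (j + 1) := by
  rw [coeff_cnar_succ, show (2 * m + 1) / 2 = m by omega,
    show (2 * m + 1 + 1) / 2 = m + 1 by omega,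
    show (2 * j + 1) / 2 = j by omega, show (2 * j + 1 + 1) / 2 = j + 1 by omega, Nat.cast_mul]

theorem coeff_narayana_succ (n k : ℕ) :
    (narayana (n + 1)).coeff k =
      (((n + 1).choose k * n.choose k / (k + 1) : ℕ) : ℤ) := by
  simp only [narayana, Nat.add_one_ne_zero, if_false, finsetSum_coeff, coeff_C_mul_X_pow,
    Nat.add_sub_cancel, sum_ite_eq, mem_range]
  split_ifs with h
  · rfl
  · rw [Nat.choose_eq_zero_of_lt (by omega : n < k), mul_zero, Nat.zero_div, Nat.cast_zero]

/-- The Narayana numbers as a two by two determinant of binomial coefficients. -/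
theorem narayana_number_eq_sub (n k : ℕ) :
    (((n + 1).choose (k + 1) * n.choose (k + 1) / (k + 2) : ℕ) : ℤ) =
      (n.choose (k + 1) : ℤ) * (n + 1).choose (k + 1) -
        (n.choose k : ℤ) * (n + 1).choose (k + 2) := by
  have h : (n + 1).choose (k + 1) * n.choose (k + 1) =
      (k + 2) * ((n + 1).choose (k + 1) * n.choose (k + 1)) -
        (k + 2) * (n.choose k * (n + 1).choose (k + 2)) := by
    have h₁ := Nat.choose_succ_right_eq n k
    have h₂ := Nat.choose_succ_right_eq (n + 1) (k + 1)
    rw [Nat.add_sub_add_right] at h₂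
    have h₃ : (k + 2) * (n.choose k * (n + 1).choose (k + 2)) =
        (k + 1) * ((n + 1).choose (k + 1) * n.choose (k + 1)) := by
      calc _ = n.choose k * ((n + 1).choose (k + 1 + 1) * (k + 1 + 1)) := by ring
        _ = (n + 1).choose (k + 1) * (n.choose k * (n - k)) := by rw [h₂]; ring
        _ = _ := by rw [← h₁]; ring
    rw [h₃, ← Nat.sub_mul, show k + 2 - (k + 1) = 1 by omega, one_mul]
  have hle : n.choose k * (n + 1).choose (k + 2) ≤ (n + 1).choose (k + 1) * n.choose (k + 1) := by
    by_contra! hlt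
    have hz : (n + 1).choose (k + 1) * n.choose (k + 1) = 0 := by
      rw [h, Nat.sub_eq_zero_of_le (Nat.mul_le_mul_left _ hlt.le)]
    rcases Nat.mul_eq_zero.mp hz with h0 | h0 <;> rw [Nat.choose_eq_zero_iff] at h0 <;>
      rw [Nat.choose_eq_zero_of_lt (by omega : n + 1 < k + 2)] at hlt <;> omega
  rw [h, ← Nat.mul_sub, Nat.mul_div_cancel_left _ (by omega), Nat.cast_sub hle]
  push_cast
  ring

theorem cnar_two_mul_add_two (m : ℕ) :
    cnar (2 * m + 2) = (1 + X) * cnar (2 * m + 1) := by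
  ext k
  rw [add_mul, one_mul, coeff_add]
  obtain ⟨j, rfl | rfl⟩ := Nat.even_or_odd' k
  · cases j with
    | zero => simp [coeff_cnar_succ]
    | succ j =>
      rw [coeff_cnar_even_even, coeff_cnar_odd_even, show 2 * (j + 1) = 2 * j + 1 + 1 by ring,
        coeff_X_mul, coeff_cnar_odd_odd, Nat.choose_succ_succ]
      push_cast
      ring
  · rw [coeff_X_mul, coeff_cnar_even_odd, coeff_cnar_odd_even, coeff_cnar_odd_odd,
      Nat.choose_succ_succ]
    push_cast
    ring

theorem cnar_two_mul_add_three (m : ℕ) :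
    cnar (2 * (m + 1) + 1) =
      (1 + X) * cnar (2 * m + 2) - X * (narayana (m + 1)).comp (X ^ 2) := by
  rw [← expand_eq_comp_X_pow]
  ext k
  rw [add_mul, one_mul, coeff_sub, coeff_add]
  obtain ⟨j, rfl | rfl⟩ := Nat.even_or_odd' k
  · cases j with
    | zero => simp [coeff_cnar_succ]
    | succ j =>
      rw [coeff_cnar_even_even, coeff_cnar_odd_even, show 2 * (j + 1) = 2 * j + 1 + 1 by ring,
        coeff_X_mul, coeff_X_mul, coeff_cnar_even_odd, coeff_expand two_pos,
        if_neg (by omega), Nat.choose_succ_succ]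
      push_cast
      ring
  · rw [coeff_X_mul, coeff_X_mul, coeff_cnar_even_odd, coeff_cnar_odd_odd,
      coeff_cnar_even_even, coeff_expand_mul' two_pos, coeff_narayana_succ]
    cases j with
    | zero => simp
    | succ j =>
      rw [narayana_number_eq_sub, Nat.choose_succ_succ m j]
      push_cast
      ring

/-- The recursion for `c_n(t)`: `c_{2n}(t) = (1+t)·c_{2n-1}(t)` for `n ≥ 1`, and
`c_{2n+1}(t) = (1+t)·c_{2n}(t) - t·C_n(t²)` for `n ≥ 0`, `C_n` being the Narayana polynomial. -/
theorem cnar_recursion :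
    (∀ n : ℕ, 1 ≤ n → cnar (2 * n) = (1 + Polynomial.X) * cnar (2 * n - 1)) ∧
      (∀ n : ℕ, cnar (2 * n + 1) =
        (1 + Polynomial.X) * cnar (2 * n)
          - Polynomial.X * (narayana n).comp (Polynomial.X ^ 2)) := by
  refine ⟨fun n hn => ?_, fun n => ?_⟩
  · obtain ⟨m, rfl⟩ := Nat.exists_eq_add_of_le' hn
    exact cnar_two_mul_add_two m
  · cases n with
    | zero =>
      simp [cnar, narayana, sum_range_succ]
    | succ m => exact cnar_two_mul_add_three m
end

section
/- Theorem 1: with the weight sequences s_k = (-1)^k·(1+t) and t_k = -t (in ℤ[t]), the Jacobi-type array satisfies a(n,0) = c_{n+1}(t) for all n ≥ 0; i.e., the generating function Σ_{n≥0} c_{n+1}(t) z^n has the Jacobi continued fraction expansion with s_n = (-1)^n(1+t) and t_n = -t. -/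
open Polynomial Finset

/-- The sum `∑ i, binom(m,i)·binom(l,i+j)·x^i`. -/
def chooseSum {R : Type*} [CommRing R] (x : R) (m l j : ℕ) : R :=
  ∑ i ∈ Finset.range (m + 1), (m.choose i : R) * (l.choose (i + j) : R) * x ^ i

section ChooseSum

variable {R : Type*} [CommRing R] (x : R)

theorem chooseSum_succ_right (m l j : ℕ) :
    chooseSum x m (l + 1) (j + 1) = chooseSum x m l j + chooseSum x m l (j + 1) := by
  simp only [chooseSum, ← Finset.sum_add_distrib, ← add_assoc, Nat.choose_succ_succ']
  refine Finset.sum_congr rfl fun i _ => ?_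
  push_cast
  ring

theorem chooseSum_eq_sum_range_add_two (m l j : ℕ) :
    chooseSum x m l j =
      ∑ i ∈ Finset.range (m + 2), (m.choose i : R) * (l.choose (i + j) : R) * x ^ i := by
  rw [Finset.sum_range_succ _ (m + 1)]
  simp [chooseSum]

theorem chooseSum_succ_left (m l j : ℕ) :
    chooseSum x (m + 1) l j = chooseSum x m l j + x * chooseSum x m l (j + 1) := by
  rw [chooseSum_eq_sum_range_add_two x m l j, chooseSum, Finset.sum_range_succ',
    Finset.sum_range_succ' _ (m + 1), chooseSum, Finset.mul_sum, add_right_comm,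
    ← Finset.sum_add_distrib]
  simp only [Nat.choose_zero_right]
  congr 1
  refine Finset.sum_congr rfl fun i _ => ?_
  rw [Nat.choose_succ_succ', add_right_comm i 1 j, add_assoc i j 1]
  push_cast
  ring

theorem chooseSum_self_succ_zero (m : ℕ) :
    chooseSum x m (m + 1) 0 = chooseSum x m m 0 + x * chooseSum x m m 1 := by
  rw [← chooseSum_succ_left, chooseSum_eq_sum_range_add_two, chooseSum]
  exact Finset.sum_congr rfl fun i _ => by simp only [add_zero]; ring

theorem chooseSum_succ_succ_zero (m : ℕ) :
    chooseSum x (m + 1) (m + 1) 0 =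
      (1 + x) * chooseSum x m m 0 + 2 * x * chooseSum x m m 1 := by
  rw [chooseSum_succ_left, chooseSum_self_succ_zero, chooseSum_succ_right]
  ring

theorem chooseSum_succ_succ_succ (m j : ℕ) :
    chooseSum x (m + 1) (m + 1) (j + 1) =
      chooseSum x m m j + (1 + x) * chooseSum x m m (j + 1) + x * chooseSum x m m (j + 2) := by
  rw [chooseSum_succ_left, chooseSum_succ_right, chooseSum_succ_right]
  ring

end ChooseSum

/-- The entry in row `2 * m` and column `2 * j` of the Jacobi-type array with weights
`(-1) ^ k * (1 + t)` and `-t`. -/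
def evenEntry {R : Type*} [CommRing R] (t : R) (m j : ℕ) : R :=
  chooseSum (t ^ 2) m m j + t * chooseSum (t ^ 2) m m (j + 1)

section JacobiArray

variable {R : Type*} [CommRing R] (t : R)

theorem evenEntry_zero (j : ℕ) : evenEntry t 0 j = if j = 0 then 1 else 0 := by
  cases j <;> simp [evenEntry, chooseSum]

theorem evenEntry_succ_zero (m : ℕ) :
    evenEntry t (m + 1) 0 = (1 + t + t ^ 2) * evenEntry t m 0 + t ^ 2 * evenEntry t m 1 := by
  simp only [evenEntry, chooseSum_succ_succ_zero, chooseSum_succ_succ_succ]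
  ring

theorem evenEntry_succ_succ (m j : ℕ) :
    evenEntry t (m + 1) (j + 1) =
      evenEntry t m j + (1 + t ^ 2) * evenEntry t m (j + 1) + t ^ 2 * evenEntry t m (j + 2) := by
  simp only [evenEntry, chooseSum_succ_succ_succ]
  ring

/-- The Jacobi-type array with weights `(-1) ^ k * (1 + t)` and `-t`. -/
def alternatingJacobi (n k : ℕ) : R :=
  jacobiA (fun k => (-1 : R) ^ k * (1 + t)) (fun _ => -t) n k

theorem alternatingJacobi_succ_zero (n : ℕ) :
    alternatingJacobi t (n + 1) 0 =
      (1 + t) * alternatingJacobi t n 0 - t * alternatingJacobi t n 1 := by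
  simp [alternatingJacobi, jacobiA, sub_eq_add_neg]

theorem alternatingJacobi_succ_succ (n k : ℕ) :
    alternatingJacobi t (n + 1) (k + 1) = alternatingJacobi t n k
      + (-1) ^ (k + 1) * (1 + t) * alternatingJacobi t n (k + 1)
      - t * alternatingJacobi t n (k + 2) := by
  simp [alternatingJacobi, jacobiA, sub_eq_add_neg]

theorem alternatingJacobi_odd_row {m : ℕ}
    (h0 : ∀ j, alternatingJacobi t (2 * m) (2 * j) = evenEntry t m j)
    (h1 : ∀ j, alternatingJacobi t (2 * m) (2 * j + 1) = 0) (j : ℕ) :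
    alternatingJacobi t (2 * m + 1) (2 * j) = (1 + t) * evenEntry t m j ∧
      alternatingJacobi t (2 * m + 1) (2 * j + 1) =
        evenEntry t m j - t * evenEntry t m (j + 1) := by
  constructor
  · cases j with
    | zero =>
      have e0 := h0 0
      have e1 := h1 0
      simp only [mul_zero, zero_add] at e0 e1 ⊢
      rw [alternatingJacobi_succ_zero, e0, e1]
      ring
    | succ j =>
      rw [show 2 * (j + 1) = 2 * j + 1 + 1 by ring, alternatingJacobi_succ_succ, h1,
        show 2 * j + 1 + 1 = 2 * (j + 1) by ring, show 2 * j + 1 + 2 = 2 * (j + 1) + 1 by ring,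
        h0, h1, pow_mul]
      ring
  · rw [alternatingJacobi_succ_succ, h0, h1, show 2 * j + 2 = 2 * (j + 1) by ring, h0]
    ring

theorem alternatingJacobi_even_row (m : ℕ) :
    ∀ j, alternatingJacobi t (2 * m) (2 * j) = evenEntry t m j ∧
      alternatingJacobi t (2 * m) (2 * j + 1) = 0 := by
  induction m with
  | zero => intro j; simp [alternatingJacobi, jacobiA, evenEntry_zero]
  | succ m ih =>
    have h := alternatingJacobi_odd_row t (fun j => (ih j).1) (fun j => (ih j).2)
    intro j
    rw [show 2 * (m + 1) = 2 * m + 1 + 1 by ring]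
    constructor
    · cases j with
      | zero =>
        have e := h 0
        simp only [mul_zero, zero_add] at e ⊢
        rw [alternatingJacobi_succ_zero, e.1, e.2, evenEntry_succ_zero]
        ring
      | succ j =>
        rw [show 2 * (j + 1) = 2 * j + 1 + 1 by ring, alternatingJacobi_succ_succ,
          (h j).2, show 2 * j + 1 + 1 = 2 * (j + 1) by ring,
          show 2 * j + 1 + 2 = 2 * (j + 1) + 1 by ring, (h _).1, (h _).2, pow_mul,
          evenEntry_succ_succ]
        ring
    · rw [alternatingJacobi_succ_succ, (h j).1, (h j).2,
        show 2 * j + 2 = 2 * (j + 1) by ring, (h _).1, pow_succ, pow_mul]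
      simp only [even_two, Even.neg_pow, one_pow]
      ring

theorem alternatingJacobi_even_zero (m : ℕ) :
    alternatingJacobi t (2 * m) 0 = evenEntry t m 0 :=
  (alternatingJacobi_even_row t m 0).1

theorem alternatingJacobi_odd_zero (m : ℕ) :
    alternatingJacobi t (2 * m + 1) 0 = (1 + t) * evenEntry t m 0 :=
  (alternatingJacobi_odd_row t (fun j => (alternatingJacobi_even_row t m j).1)
    (fun j => (alternatingJacobi_even_row t m j).2) 0).1

end JacobiArray

theorem sum_range_two_mul {M : Type*} [AddCommMonoid M] (f : ℕ → M) (n : ℕ) :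
    ∑ k ∈ Finset.range (2 * n), f k = ∑ i ∈ Finset.range n, (f (2 * i) + f (2 * i + 1)) := by
  induction n with
  | zero => simp
  | succ n ih =>
    rw [show 2 * (n + 1) = 2 * n + 1 + 1 by ring, Finset.sum_range_succ, Finset.sum_range_succ,
      Finset.sum_range_succ, ih, add_assoc]

theorem sum_choose_half_mul_choose_half {R : Type*} [CommRing R] (t : R) (m l : ℕ) :
    ∑ k ∈ Finset.range (2 * (m + 1)),
        (m.choose (k / 2) : R) * (l.choose ((k + 1) / 2) : R) * t ^ k =
      chooseSum (t ^ 2) m l 0 + t * chooseSum (t ^ 2) m l 1 := by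
  rw [sum_range_two_mul, chooseSum, chooseSum, Finset.mul_sum, ← Finset.sum_add_distrib]
  refine Finset.sum_congr rfl fun i _ => ?_
  rw [show 2 * i / 2 = i by lia, show (2 * i + 1) / 2 = i by lia,
    show (2 * i + 1 + 1) / 2 = i + 1 by lia, add_zero]
  ring

theorem cnar_odd (m : ℕ) : cnar (2 * m + 1) = evenEntry Polynomial.X m 0 := by
  rw [evenEntry, ← sum_choose_half_mul_choose_half, cnar, if_neg (by lia),
    show (2 * m + 1 - 1) / 2 = m by lia, show (2 * m + 1) / 2 = m by lia]
  simp [mul_add]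

theorem cnar_even (m : ℕ) :
    cnar (2 * m + 2) = (1 + Polynomial.X) * evenEntry Polynomial.X m 0 := by
  have h : (1 + Polynomial.X) * evenEntry Polynomial.X m 0 =
      chooseSum ((Polynomial.X : Polynomial ℤ) ^ 2) m (m + 1) 0 +
        Polynomial.X * chooseSum (Polynomial.X ^ 2) m (m + 1) 1 := by
    rw [evenEntry, chooseSum_self_succ_zero, chooseSum_succ_right]
    ring
  rw [h, ← sum_choose_half_mul_choose_half, cnar, if_neg (by lia),
    show (2 * m + 2 - 1) / 2 = m by lia, show (2 * m + 2) / 2 = m + 1 by lia,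
    Finset.sum_range_succ, show (2 * m + 2) / 2 = m + 1 by lia]
  simp [mul_add]

/-- Theorem 1: with weights `s_k = (-1)^k (1+t)`, `t_k = -t` in `ℤ[t]`, the Jacobi-type
array satisfies `a(n,0) = c_{n+1}(t)`. -/
theorem jacobi_cnar_shifted (n : ℕ) :
    jacobiA (fun k => (-1 : Polynomial ℤ) ^ k * (1 + Polynomial.X))
        (fun _ => -Polynomial.X) n 0 = cnar (n + 1) := by
  obtain ⟨m, rfl | rfl⟩ := Nat.even_or_odd' n
  · rw [cnar_odd]
    exact alternatingJacobi_even_zero _ m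
  · rw [cnar_even]
    exact alternatingJacobi_odd_zero _ m
end

section
/- In the ring of formal power series in z over ℚ[t], with c(z) = Σ_{n≥0} c_n(t)·z^n and c̄(z) = Σ_{n≥0} c_n(-t)·z^n (i.e., c with t replaced by -t), one has c(z)·c̄(-z) = Σ_{n≥0} C_n(t²)·z^{2n}; equivalently, for every n ≥ 0, Σ_{j=0}^{n} (-1)^j·c_{n-j}(t)·c_j(-t) equals C_{n/2}(t²) if n is even and 0 if n is odd. -/
open Polynomial Finset

/-- `c_n(t)` as a polynomial over `ℚ`. -/
noncomputable def cnarQ (n : ℕ) : Polynomial ℚ := (cnar n).map (Int.castRingHom ℚ)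

/-- `c_n(-t)` over `ℚ`: `c_n` with `t` replaced by `-t`. -/
noncomputable def cnarQneg (n : ℕ) : Polynomial ℚ := (cnarQ n).comp (-Polynomial.X)

/-- `C_n(t²) ∈ ℚ[t]`: the Narayana polynomial with `t` replaced by `t²`, over `ℚ`. -/
noncomputable def narayanaSqQ (n : ℕ) : Polynomial ℚ :=
  ((narayana n).comp (Polynomial.X ^ 2)).map (Int.castRingHom ℚ)

/-- The polynomial `∑ i, binom(m, i) * binom(m, i + d) * x ^ i`. -/
noncomputable def chooseCorr (d m : ℕ) : ℚ[X] :=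
  ∑ i ∈ range (m + 1), C ((m.choose i * m.choose (i + d) : ℕ) : ℚ) * X ^ i

theorem coeff_chooseCorr (d m i : ℕ) :
    (chooseCorr d m).coeff i = m.choose i * m.choose (i + d) := by
  simp only [chooseCorr, finsetSum_coeff, coeff_C_mul, coeff_X_pow, mul_ite, mul_one, mul_zero,
    Finset.sum_ite_eq, mem_range, Nat.cast_mul]
  split_ifs with h
  · rfl
  · simp [Nat.choose_eq_zero_of_lt (show m < i by lia)]

theorem cast_choose_succ_right (m i : ℕ) :
    (m.choose (i + 1) : ℚ) * (i + 1) = m.choose i * (m - i) := by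
  rcases le_or_gt i m with h | h
  · have := Nat.choose_succ_right_eq m i
    rw [← Nat.cast_sub h]
    exact_mod_cast this
  · simp [Nat.choose_eq_zero_of_lt h, Nat.choose_eq_zero_of_lt (h.trans (Nat.lt_succ_self i))]

theorem chooseCorr_zero_succ (m : ℕ) :
    chooseCorr 0 (m + 1) = (1 + X) * chooseCorr 0 m + 2 * X * chooseCorr 1 m := by
  rw [show (1 + X) * chooseCorr 0 m + 2 * X * chooseCorr 1 m =
    chooseCorr 0 m + X * (chooseCorr 0 m + chooseCorr 1 m + chooseCorr 1 m) by ring]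
  ext i
  rcases i with _ | i
  · simp [coeff_chooseCorr]
  · simp only [coeff_add, coeff_X_mul, coeff_chooseCorr, add_zero, Nat.choose_succ_succ]
    push_cast
    ring

theorem chooseCorr_one_succ (m : ℕ) :
    2 * ((m : ℚ[X]) + 1) * chooseCorr 0 m =
      ((m : ℚ[X]) + 2) * chooseCorr 1 (m + 1) - (1 + X) * (((m : ℚ[X]) + 1) * chooseCorr 1 m) := by
  rw [show 2 * ((m : ℚ[X]) + 1) * chooseCorr 0 m = C (2 * ((m : ℚ) + 1)) * chooseCorr 0 m by
      simp [map_ofNat (C : ℚ →+* ℚ[X])],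
    show ((m : ℚ[X]) + 2) * chooseCorr 1 (m + 1) - (1 + X) * (((m : ℚ[X]) + 1) * chooseCorr 1 m) =
      C ((m : ℚ) + 2) * chooseCorr 1 (m + 1) -
        (C ((m : ℚ) + 1) * chooseCorr 1 m + X * (C ((m : ℚ) + 1) * chooseCorr 1 m)) by
      simp [map_ofNat (C : ℚ →+* ℚ[X])]; ring]
  ext i
  rcases i with _ | i
  · simp [coeff_chooseCorr]
    ring
  · simp only [coeff_add, coeff_sub, coeff_X_mul, coeff_C_mul, coeff_chooseCorr, add_zero,
      Nat.choose_succ_succ]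
    have h₁ := cast_choose_succ_right m i
    have h₂ := cast_choose_succ_right m (i + 1)
    push_cast at h₁ h₂ ⊢
    generalize (m.choose i : ℚ) = a at *
    generalize (m.choose (i + 1) : ℚ) = b at *
    generalize (m.choose (i + 1 + 1) : ℚ) = c at *
    linear_combination (b + c) * h₁ - (a + b) * h₂

theorem coeff_sum_range_C_mul_X_pow {R : Type*} [Semiring R] (f : ℕ → R) (n k : ℕ) :
    (∑ i ∈ range n, C (f i) * X ^ i).coeff k = if k < n then f k else 0 := by
  simp [coeff_X_pow]

theorem choose_succ_mul_choose_div (m k : ℕ) :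
    (((m + 1).choose k * m.choose k / (k + 1) : ℕ) : ℚ) =
      (m + 1).choose k * m.choose k / (k + 1) := by
  rw [Nat.cast_div]
  · push_cast; rfl
  · rcases k with _ | k
    · simp
    rw [← Int.natCast_dvd_natCast]
    refine ⟨(m.choose (k + 1) : ℤ) ^ 2 - m.choose k * m.choose (k + 1 + 1), ?_⟩
    have h₁ := cast_choose_succ_right m k
    have h₂ := cast_choose_succ_right m (k + 1)
    rw [← Int.cast_inj (α := ℚ), Nat.choose_succ_succ]
    push_cast at h₁ h₂ ⊢
    linear_combination (-(m.choose (k + 1) : ℚ)) * h₁ + (m.choose k : ℚ) * h₂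
  · positivity

theorem map_narayana_succ (m : ℕ) :
    (narayana (m + 1)).map (Int.castRingHom ℚ) =
      2 * chooseCorr 0 m + (1 + X) * chooseCorr 1 m - chooseCorr 1 (m + 1) := by
  rw [show 2 * chooseCorr 0 m + (1 + X) * chooseCorr 1 m - chooseCorr 1 (m + 1) =
    chooseCorr 0 m + chooseCorr 0 m + chooseCorr 1 m + X * chooseCorr 1 m
      - chooseCorr 1 (m + 1) by ring]
  ext k
  have hk : ((narayana (m + 1)).map (Int.castRingHom ℚ)).coeff k =
      (m + 1).choose k * m.choose k / (k + 1) := by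
    rw [coeff_map, narayana, if_neg m.succ_ne_zero, coeff_sum_range_C_mul_X_pow]
    split_ifs with h
    · rw [← choose_succ_mul_choose_div m k]
      simp only [eq_intCast, Int.cast_natCast, Nat.add_sub_cancel]
    · simp [Nat.choose_eq_zero_of_lt (show m < k by lia)]
  rw [hk, div_eq_iff (by positivity)]
  rcases k with _ | k
  · simp [coeff_chooseCorr]
    ring
  · simp only [coeff_add, coeff_sub, coeff_X_mul, coeff_chooseCorr, add_zero,
      Nat.choose_succ_succ]
    have h₁ := cast_choose_succ_right m k
    have h₂ := cast_choose_succ_right m (k + 1)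
    push_cast at h₁ h₂ ⊢
    generalize (m.choose k : ℚ) = a at *
    generalize (m.choose (k + 1) : ℚ) = b at *
    generalize (m.choose (k + 1 + 1) : ℚ) = c at *
    linear_combination (-b) * h₁ + a * h₂

theorem coeff_cnarQ {n : ℕ} (hn : n ≠ 0) (k : ℕ) :
    (cnarQ n).coeff k = ((n - 1) / 2).choose (k / 2) * (n / 2).choose ((k + 1) / 2) := by
  rw [cnarQ, coeff_map, cnar, if_neg hn, coeff_sum_range_C_mul_X_pow]
  split_ifs with h
  · simp
  · simp [Nat.choose_eq_zero_of_lt (show n / 2 < (k + 1) / 2 by lia)]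

theorem coeff_even_expand_add {R : Type*} [CommSemiring R] (p q : R[X]) (i : ℕ) :
    (expand R 2 p + X * expand R 2 q).coeff (2 * i) = p.coeff i := by
  rcases i with _ | i
  · simpa using coeff_expand_mul' two_pos p 0
  · rw [coeff_add, coeff_expand_mul' two_pos, show 2 * (i + 1) = 2 * i + 1 + 1 by ring, coeff_X_mul,
      coeff_expand two_pos, if_neg (by lia), add_zero]

theorem coeff_odd_expand_add {R : Type*} [CommSemiring R] (p q : R[X]) (i : ℕ) :
    (expand R 2 p + X * expand R 2 q).coeff (2 * i + 1) = q.coeff i := by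
  rw [coeff_add, coeff_X_mul, coeff_expand_mul' two_pos, coeff_expand two_pos, if_neg (by lia),
    zero_add]

theorem cnarQ_odd (m : ℕ) :
    cnarQ (2 * m + 1) = expand ℚ 2 (chooseCorr 0 m) + X * expand ℚ 2 (chooseCorr 1 m) := by
  ext k
  rw [coeff_cnarQ (by lia), show (2 * m + 1 - 1) / 2 = m by lia, show (2 * m + 1) / 2 = m by lia]
  obtain ⟨i, rfl | rfl⟩ := k.even_or_odd'
  · rw [coeff_even_expand_add, coeff_chooseCorr, show 2 * i / 2 = i by lia,
      show (2 * i + 1) / 2 = i + 0 by lia]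
  · rw [coeff_odd_expand_add, coeff_chooseCorr, show (2 * i + 1) / 2 = i by lia,
      show (2 * i + 1 + 1) / 2 = i + 1 by lia]

theorem cnarQ_even (m : ℕ) :
    cnarQ (2 * m + 2) = expand ℚ 2 (chooseCorr 0 m + X * chooseCorr 1 m) +
      X * expand ℚ 2 (chooseCorr 0 m + chooseCorr 1 m) := by
  ext k
  rw [coeff_cnarQ (by lia), show (2 * m + 2 - 1) / 2 = m by lia,
    show (2 * m + 2) / 2 = m + 1 by lia]
  obtain ⟨i, rfl | rfl⟩ := k.even_or_odd'
  · rw [coeff_even_expand_add, show 2 * i / 2 = i by lia, show (2 * i + 1) / 2 = i by lia]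
    rcases i with _ | i
    · simp [coeff_chooseCorr]
    · simp only [coeff_add, coeff_X_mul, coeff_chooseCorr, add_zero, Nat.choose_succ_succ]
      push_cast
      ring
  · rw [coeff_odd_expand_add, show (2 * i + 1) / 2 = i by lia,
      show (2 * i + 1 + 1) / 2 = i + 1 by lia]
    simp only [coeff_add, coeff_chooseCorr, add_zero, Nat.choose_succ_succ]
    push_cast
    ring

/-- The generating series `∑ m, chooseCorr d m * w ^ m`. -/
noncomputable def chooseCorrSeries (d : ℕ) : PowerSeries ℚ[X] :=
  PowerSeries.mk (chooseCorr d)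

theorem chooseCorr_zero_right_zero : chooseCorr 0 0 = 1 := by
  simp [chooseCorr]

theorem chooseCorr_one_right_zero : chooseCorr 1 0 = 0 := by
  simp [chooseCorr]

theorem chooseCorrSeries_zero_eq :
    (1 - PowerSeries.C (1 + X) * PowerSeries.X) * chooseCorrSeries 0 =
      1 + 2 * PowerSeries.C X * (PowerSeries.X * chooseCorrSeries 1) := by
  rw [← sub_eq_zero, show (1 - PowerSeries.C (1 + X) * PowerSeries.X) * chooseCorrSeries 0 -
      (1 + 2 * PowerSeries.C X * (PowerSeries.X * chooseCorrSeries 1)) =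
      chooseCorrSeries 0 - 1 - PowerSeries.X * (PowerSeries.C (1 + X) * chooseCorrSeries 0
        + PowerSeries.C (2 * X) * chooseCorrSeries 1) by
    rw [map_mul, map_ofNat]; ring]
  ext1 m
  rcases m with _ | m
  · simp [chooseCorrSeries, chooseCorr_zero_right_zero]
  · simp only [chooseCorrSeries, map_sub, PowerSeries.coeff_succ_X_mul, PowerSeries.coeff_one,
      PowerSeries.coeff_mk, map_add (PowerSeries.coeff m), PowerSeries.coeff_C_mul,
      chooseCorr_zero_succ]
    simp

theorem chooseCorrSeries_derivative_eq :
    2 * PowerSeries.X *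
        PowerSeries.derivative ℚ[X] (PowerSeries.X * chooseCorrSeries 0) =
      (1 - PowerSeries.C (1 + X) * PowerSeries.X) *
        PowerSeries.derivative ℚ[X] (PowerSeries.X * chooseCorrSeries 1) := by
  set u := PowerSeries.derivative ℚ[X] (PowerSeries.X * chooseCorrSeries 0) with hu
  set v := PowerSeries.derivative ℚ[X] (PowerSeries.X * chooseCorrSeries 1) with hv
  rw [← sub_eq_zero, show 2 * PowerSeries.X * u - (1 - PowerSeries.C (1 + X) * PowerSeries.X) * v =
    PowerSeries.X * (PowerSeries.C 2 * u + PowerSeries.C (1 + X) * v) - v by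
    rw [map_ofNat]; ring]
  ext1 m
  rcases m with _ | m
  · simp [hv, chooseCorrSeries, chooseCorr_one_right_zero]
  · have := chooseCorr_one_succ m
    simp only [map_sub, map_add (PowerSeries.coeff _), PowerSeries.coeff_succ_X_mul,
      PowerSeries.coeff_C_mul, hu, hv,
      PowerSeries.coeff_derivative, chooseCorrSeries, PowerSeries.coeff_mk, map_zero]
    push_cast
    linear_combination this

theorem chooseCorrSeries_quadratic :
    chooseCorrSeries 1 + PowerSeries.C X * PowerSeries.X * chooseCorrSeries 1 ^ 2 =
      PowerSeries.X * chooseCorrSeries 0 ^ 2 := by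
  have h₁ := chooseCorrSeries_zero_eq
  have h₂ := chooseCorrSeries_derivative_eq
  set u := PowerSeries.X * chooseCorrSeries 0 with hu
  set v := PowerSeries.X * chooseCorrSeries 1 with hv
  have key : v + PowerSeries.C X * v ^ 2 - u ^ 2 = 0 := by
    apply PowerSeries.derivative.ext
    · simp only [map_sub, map_add, Derivation.leibniz, PowerSeries.derivative_pow,
        PowerSeries.derivative_C, map_zero, smul_eq_mul]
      push_cast
      simp only [pow_one]
      linear_combination (-PowerSeries.derivative ℚ[X] v) * h₁ - chooseCorrSeries 0 * h₂
    · simp [hu, hv]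
  apply mul_left_cancel₀ (PowerSeries.X_ne_zero (R := ℚ[X]))
  rw [hu, hv] at key
  linear_combination key

/-- The substitution `x ↦ t ^ 2`, `w ↦ z ^ 2`. -/
noncomputable def expandTwo : PowerSeries ℚ[X] →+* PowerSeries ℚ[X] :=
  (RingHomClass.toRingHom (PowerSeries.expand (R := ℚ[X]) 2 two_ne_zero)).comp
    (PowerSeries.map (RingHomClass.toRingHom (expand ℚ 2)))

theorem coeff_expandTwo_even (f : PowerSeries ℚ[X]) (m : ℕ) :
    PowerSeries.coeff (2 * m) (expandTwo f) = expand ℚ 2 (PowerSeries.coeff m f) := by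
  simp [expandTwo, -PowerSeries.map_expand]

theorem coeff_expandTwo_odd (f : PowerSeries ℚ[X]) (m : ℕ) :
    PowerSeries.coeff (2 * m + 1) (expandTwo f) = 0 := by
  simp only [expandTwo, RingHom.comp_apply, RingHom.coe_coe]
  exact PowerSeries.coeff_expand_of_not_dvd _ _ _ (by lia)

theorem expandTwo_C_X : expandTwo (PowerSeries.C X) = PowerSeries.C X ^ 2 := by
  simp [expandTwo, PowerSeries.expand_C]

theorem expandTwo_X : expandTwo PowerSeries.X = PowerSeries.X ^ 2 := by
  simp [expandTwo]

theorem powerSeries_ext_parity {R : Type*} [Semiring R] {f g : PowerSeries R}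
    (h₀ : PowerSeries.coeff 0 f = PowerSeries.coeff 0 g)
    (h₁ : ∀ m, PowerSeries.coeff (2 * m + 1) f = PowerSeries.coeff (2 * m + 1) g)
    (h₂ : ∀ m, PowerSeries.coeff (2 * m + 1 + 1) f = PowerSeries.coeff (2 * m + 1 + 1) g) :
    f = g := by
  ext1 n
  obtain ⟨m, rfl | rfl⟩ := n.even_or_odd'
  · rcases m with _ | m
    · exact h₀
    · exact h₂ m
  · exact h₁ m

theorem coeff_expandTwo_succ_succ (f : PowerSeries ℚ[X]) (m : ℕ) :
    PowerSeries.coeff (2 * m + 1 + 1) (expandTwo f) = expand ℚ 2 (PowerSeries.coeff (m + 1) f) :=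
  coeff_expandTwo_even f (m + 1)

theorem coeff_zero_expandTwo (f : PowerSeries ℚ[X]) :
    PowerSeries.coeff 0 (expandTwo f) = expand ℚ 2 (PowerSeries.coeff 0 f) :=
  coeff_expandTwo_even f 0

theorem cnarQ_zero : cnarQ 0 = 1 := by
  simp [cnarQ, cnar]

theorem mk_cnarQ :
    PowerSeries.mk (fun n => cnarQ n) =
      expandTwo (1 + PowerSeries.X * (chooseCorrSeries 0 + PowerSeries.C X * chooseCorrSeries 1)) +
      PowerSeries.C X * expandTwo (PowerSeries.X * (chooseCorrSeries 0 + chooseCorrSeries 1)) +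
      PowerSeries.X * (expandTwo (chooseCorrSeries 0) +
        PowerSeries.C X * expandTwo (chooseCorrSeries 1)) := by
  refine powerSeries_ext_parity ?_ (fun m => ?_) (fun m => ?_)
  · simp only [PowerSeries.coeff_mk, cnarQ_zero, map_add (PowerSeries.coeff _),
      PowerSeries.coeff_C_mul, PowerSeries.coeff_zero_X_mul, coeff_zero_expandTwo]
    simp
  · simp only [PowerSeries.coeff_mk, cnarQ_odd, map_add (PowerSeries.coeff _),
      PowerSeries.coeff_C_mul, PowerSeries.coeff_succ_X_mul, coeff_expandTwo_odd,
      coeff_expandTwo_even, chooseCorrSeries]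
    ring
  · simp only [PowerSeries.coeff_mk, cnarQ_even, map_add (PowerSeries.coeff _),
      PowerSeries.coeff_C_mul, PowerSeries.coeff_succ_X_mul, coeff_expandTwo_odd,
      coeff_expandTwo_succ_succ, chooseCorrSeries, PowerSeries.coeff_one]
    simp

theorem expand_two_comp_neg_X {R : Type*} [CommRing R] (p : R[X]) :
    (expand R 2 p).comp (-X) = expand R 2 p := by
  rw [expand_eq_comp_X_pow, comp_assoc]
  simp

theorem mk_neg_cnarQneg :
    PowerSeries.mk (fun n => (-1 : ℚ[X]) ^ n * cnarQneg n) =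
      expandTwo (1 + PowerSeries.X * (chooseCorrSeries 0 + PowerSeries.C X * chooseCorrSeries 1)) -
      PowerSeries.C X * expandTwo (PowerSeries.X * (chooseCorrSeries 0 + chooseCorrSeries 1)) -
      PowerSeries.X * (expandTwo (chooseCorrSeries 0) -
        PowerSeries.C X * expandTwo (chooseCorrSeries 1)) := by
  refine powerSeries_ext_parity ?_ (fun m => ?_) (fun m => ?_)
  · simp only [PowerSeries.coeff_mk, cnarQneg, cnarQ_zero, map_sub (PowerSeries.coeff _),
      PowerSeries.coeff_C_mul, PowerSeries.coeff_zero_X_mul, coeff_zero_expandTwo]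
    simp
  · simp only [PowerSeries.coeff_mk, cnarQneg, cnarQ_odd, map_sub (PowerSeries.coeff _),
      PowerSeries.coeff_C_mul, PowerSeries.coeff_succ_X_mul, coeff_expandTwo_odd,
      coeff_expandTwo_even, chooseCorrSeries, add_comp, mul_comp, X_comp, expand_two_comp_neg_X,
      pow_succ, pow_mul]
    ring
  · simp only [PowerSeries.coeff_mk, cnarQneg, cnarQ_even, map_sub (PowerSeries.coeff _),
      map_add (PowerSeries.coeff _),
      PowerSeries.coeff_C_mul, PowerSeries.coeff_succ_X_mul, coeff_expandTwo_odd,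
      coeff_expandTwo_succ_succ, chooseCorrSeries, PowerSeries.coeff_one, add_comp, mul_comp,
      X_comp, expand_two_comp_neg_X, pow_succ, pow_mul]
    simp
    ring

theorem narayanaSqQ_eq_expand (n : ℕ) :
    narayanaSqQ n = expand ℚ 2 ((narayana n).map (Int.castRingHom ℚ)) := by
  rw [narayanaSqQ, ← expand_eq_comp_X_pow, map_expand]

theorem mk_narayanaSqQ :
    PowerSeries.mk (fun m => if Even m then narayanaSqQ (m / 2) else 0) =
      expandTwo (1 + PowerSeries.X * (2 * chooseCorrSeries 0 +
        PowerSeries.C (1 + X) * chooseCorrSeries 1) - chooseCorrSeries 1) := by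
  refine powerSeries_ext_parity ?_ (fun m => ?_) (fun m => ?_)
  · rw [coeff_zero_expandTwo]
    simp [narayanaSqQ, narayana, chooseCorrSeries, chooseCorr_one_right_zero]
  · rw [coeff_expandTwo_odd, PowerSeries.coeff_mk, if_neg (by simp)]
  · rw [coeff_expandTwo_succ_succ, PowerSeries.coeff_mk, if_pos ⟨m + 1, by ring⟩,
      show (2 * m + 1 + 1) / 2 = m + 1 by lia, narayanaSqQ_eq_expand, map_narayana_succ]
    congr 1
    rw [← map_ofNat (PowerSeries.C : ℚ[X] →+* _) 2]
    simp only [map_sub (PowerSeries.coeff _), map_add (PowerSeries.coeff _),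
      PowerSeries.coeff_C_mul, PowerSeries.coeff_succ_X_mul, chooseCorrSeries,
      PowerSeries.coeff_mk, PowerSeries.coeff_one]
    simp

theorem mk_cnarQ_mul_mk_neg_cnarQneg :
    PowerSeries.mk (fun n => cnarQ n) *
        PowerSeries.mk (fun n => (-1 : ℚ[X]) ^ n * cnarQneg n) =
      PowerSeries.mk (fun m => if Even m then narayanaSqQ (m / 2) else 0) := by
  have h := congrArg expandTwo chooseCorrSeries_quadratic
  rw [mk_cnarQ, mk_neg_cnarQneg, mk_narayanaSqQ]
  simp only [map_add, map_sub, map_mul, map_pow, map_one, map_ofNat, expandTwo_C_X,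
    expandTwo_X] at h ⊢
  generalize expandTwo (chooseCorrSeries 0) = P at *
  generalize expandTwo (chooseCorrSeries 1) = Q at *
  generalize (PowerSeries.C X : PowerSeries ℚ[X]) = t at *
  generalize (PowerSeries.X : PowerSeries ℚ[X]) = z at *
  linear_combination (1 - z ^ 2 + t ^ 2 * z ^ 2 + 2 * z * t) * h

/-- In `(ℚ[t])[[z]]`, with `c(z) = ∑_{n≥0} c_n(t) z^n` and `c̄(z) = ∑_{n≥0} c_n(-t) z^n`,
one has `c(z)·c̄(-z) = ∑_{n≥0} C_n(t²) z^{2n}`; equivalently, for every `n ≥ 0`,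
`∑_{j=0}^n (-1)^j c_{n-j}(t) c_j(-t)` equals `C_{n/2}(t²)` for even `n` and `0` for odd `n`. -/
theorem cnar_product_identity :
    PowerSeries.mk (fun n => cnarQ n)
        * PowerSeries.mk (fun n => (-1 : Polynomial ℚ) ^ n * cnarQneg n)
      = PowerSeries.mk (fun m => if Even m then narayanaSqQ (m / 2) else 0) ∧
      ∀ n : ℕ,
        ∑ j ∈ Finset.range (n + 1), (-1 : Polynomial ℚ) ^ j * cnarQ (n - j) * cnarQneg j
          = if Even n then narayanaSqQ (n / 2) else 0 := by
  refine ⟨mk_cnarQ_mul_mk_neg_cnarQneg, fun n => ?_⟩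
  have h := congrArg (PowerSeries.coeff n) mk_cnarQ_mul_mk_neg_cnarQneg
  rw [mul_comm, PowerSeries.coeff_mul, Finset.Nat.sum_antidiagonal_eq_sum_range_succ_mk] at h
  simp only [PowerSeries.coeff_mk] at h
  rw [← h]
  exact Finset.sum_congr rfl fun j _ => by ring
end
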